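/- Let ⊢{c}Γ be derived by the dependency type system. Then: (1) if ⟨c,σ⟩ ⇒t_a,* ⟨skip,σ'⟩ and σ ≡_{Γ(a)} ρ, then every channel-a trace t' produced by ⟨c,ρ⟩ satisfies |t| ≥ |t'|, and moreover if ⟨c,ρ⟩ ⇒t'_a,* ⟨skip,ρ'⟩ then |t| = |t'|; (2) if a ∉ Γ(a_p) then no output of any run of c is produced by an output statement at program point a_p on channel a. -/

import Mathlib

/-- Program variables. -/
abbrev PVar := String
/-- Channels. -/
abbrev Chan := String
/-- Program points. -/
abbrev PPoint := String
/-- Values. -/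
abbrev Val := ℤ
/-- Stores map program variables to values. -/
abbrev Store := PVar → Val

/-- Expressions: integer constants or variables. -/
inductive Expr where
  | const : Val → Expr
  | var : PVar → Expr
deriving DecidableEq

def Expr.eval : Expr → Store → Val
  | .const v, _ => v
  | .var x, σ => σ x

def Expr.fv : Expr → Set PVar
  | .const _ => ∅
  | .var x => {x}

/-- Commands of the while-language with annotated outputs. -/
inductive Cmd where
  | skip : Cmd
  | seq : Cmd → Cmd → Cmd
  | assign : PVar → Expr → Cmd
  | ite : Expr → Cmd → Cmd → Cmd
  | while : Expr → Cmd → Cmd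
  | out : Expr → Chan → PPoint → Cmd
deriving DecidableEq

/-- Step labels: silent, or an output (channel, value, program point). -/
inductive Label where
  | silent : Label
  | out : Chan → Val → PPoint → Label
deriving DecidableEq

abbrev Config := Cmd × Store

/-- Small-step semantics. -/
inductive Step : Config → Label → Config → Prop where
  | skipSeq : ∀ (c : Cmd) (σ : Store), Step (.seq .skip c, σ) .silent (c, σ)
  | seq : ∀ {c₁ : Cmd} {σ : Store} {α : Label} {c₁' : Cmd} {σ' : Store} (c₂ : Cmd),
      Step (c₁, σ) α (c₁', σ') → Step (.seq c₁ c₂, σ) α (.seq c₁' c₂, σ')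
  | assign : ∀ (x : PVar) (e : Expr) (σ : Store),
      Step (.assign x e, σ) .silent (.skip, Function.update σ x (e.eval σ))
  | out : ∀ (e : Expr) (a : Chan) (p : PPoint) (σ : Store),
      Step (.out e a p, σ) (.out a (e.eval σ) p) (.skip, σ)
  | whileStep : ∀ (e : Expr) (c : Cmd) (σ : Store),
      Step (.while e c, σ) .silent (.ite e (.seq c (.while e c)) .skip, σ)
  | iteTrue : ∀ {e : Expr} {σ : Store} (c₁ c₂ : Cmd),
      e.eval σ ≠ 0 → Step (.ite e c₁ c₂, σ) .silent (c₁, σ)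
  | iteFalse : ∀ {e : Expr} {σ : Store} (c₁ c₂ : Cmd),
      e.eval σ = 0 → Step (.ite e c₁ c₂, σ) .silent (c₂, σ)

/-- Prepend a label to a list of (output) labels, dropping silent labels. -/
def Label.consTo : Label → List Label → List Label
  | .silent, ls => ls
  | l, ls => l :: ls

/-- `Steps cfg ls n cfg'`: `n` evaluation steps from `cfg` to `cfg'`, producing
the list `ls` of output labels (silent steps contribute nothing). -/
inductive Steps : Config → List Label → ℕ → Config → Prop where
  | refl : ∀ cfg, Steps cfg [] 0 cfg
  | step : ∀ {cfg : Config} {α : Label} {cfg' : Config} {ls : List Label} {n : ℕ} {cfg'' : Config},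
      Step cfg α cfg' → Steps cfg' ls n cfg'' → Steps cfg (α.consTo ls) (n+1) cfg''

/-- Projection of a label list to the values output on channel `a`. -/
def projA (a : Chan) (ls : List Label) : List Val :=
  ls.filterMap fun l => match l with
    | .silent => none
    | .out b v _ => if b = a then some v else none

/-- `⟨c,σ⟩ ⇒t_a,n ⟨c',σ'⟩`: n steps producing trace `t` of values on channel `a`. -/
def ProjSteps (cfg : Config) (a : Chan) (t : List Val) (n : ℕ) (cfg' : Config) : Prop :=
  ∃ ls, Steps cfg ls n cfg' ∧ projA a ls = t

/-- `⟨c,σ⟩ ⇒t_a`: the run of `c` from `σ` produces trace `t` on channel `a`. -/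
def Produces (c : Cmd) (σ : Store) (a : Chan) (t : List Val) : Prop :=
  ∃ n cfg', ProjSteps (c, σ) a t n cfg'

/-- A forgetful attacker: a deterministic automaton over values. -/
structure Attacker (S : Type) where
  init : S
  step : S → Val → S

/-- The attacker's state after observing trace `t`. -/
def Attacker.run {S : Type} (A : Attacker S) (t : List Val) : S :=
  t.foldl A.step A.init

/-- The counting variant `A^ω` of an attacker. -/
def Attacker.omega {S : Type} (A : Attacker S) : Attacker (S × ℕ) where
  init := (A.init, 0)
  step := fun sn v => (A.step sn.1 v, sn.2 + 1)

/-- Attacker knowledge `k(A,c,a,t)`. -/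
def know {S : Type} (A : Attacker S) (c : Cmd) (a : Chan) (t : List Val) : Set Store :=
  { ρ | ∃ t', Produces c ρ a t' ∧ A.run t' = A.run t }

/-- Exclusion knowledge `ek(A,c,a,t)`. -/
def ek {S : Type} (A : Attacker S) (c : Cmd) (a : Chan) (t : List Val) : Set Store :=
  (know A c a t)ᶜ

/-- Full progress knowledge `k#(A,c,a,t)`. -/
def kSharp {S : Type} (A : Attacker S) (c : Cmd) (a : Chan) (t : List Val) : Set Store :=
  { ρ | ∃ t' v, Produces c ρ a (t' ++ [v]) ∧ A.omega.run t' = A.omega.run t }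

/-- Exclusion version `ek#(A,c,a,t)`. -/
def ekSharp {S : Type} (A : Attacker S) (c : Cmd) (a : Chan) (t : List Val) : Set Store :=
  (kSharp A c a t)ᶜ

/-- AC progress knowledge `k⁺(A,c,a,t)`. -/
def kPlus {S : Type} (A : Attacker S) (c : Cmd) (a : Chan) (t : List Val) : Set Store :=
  { ρ | ∃ t' v, Produces c ρ a (t' ++ [v]) ∧ A.run t' = A.run t }

/-- Exclusion version `ek⁺(A,c,a,t)`. -/
def ekPlus {S : Type} (A : Attacker S) (c : Cmd) (a : Chan) (t : List Val) : Set Store :=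
  (kPlus A c a t)ᶜ

/-- A dynamic policy: an equivalence relation on stores per channel and execution point. -/
structure DynPolicy where
  rel : Chan → Cmd → Store → ℕ → Store → Store → Prop
  isEquiv : ∀ a c σ n, Equivalence (rel a c σ n)

/-- Progress-insensitive security of `c` for policy `D` against attacker `A`
on channel `a` for initial store `σ`. -/
def PISecure {S : Type} (c : Cmd) (D : DynPolicy) (A : Attacker S) (a : Chan) (σ : Store) : Prop :=
  ∀ t n c' σ' v, ProjSteps (c, σ) a t n (c', σ') →
    (∃ cfg', ProjSteps (c', σ') a [v] 1 cfg') →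
    ek A c a (t ++ [v]) \ ekSharp A c a t ⊆ { ρ | ¬ D.rel a c σ n ρ σ }

/-- AC progress-insensitive security of `c` for policy `D` against attacker `A`
on channel `a` for initial store `σ`. -/
def ACPISecure {S : Type} (c : Cmd) (D : DynPolicy) (A : Attacker S) (a : Chan) (σ : Store) : Prop :=
  ∀ t n c' σ' v, ProjSteps (c, σ) a t n (c', σ') →
    (∃ cfg', ProjSteps (c', σ') a [v] 1 cfg') →
    ek A c a (t ++ [v]) \ ekPlus A c a t ⊆ { ρ | ¬ D.rel a c σ n ρ σ }

/-- Two-run progress-insensitive security. -/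
def TwoRunPISecure (c : Cmd) (D : DynPolicy) (a : Chan) (σ : Store) : Prop :=
  ∀ t n cn σn v, ProjSteps (c, σ) a t n (cn, σn) →
    (∃ cfg', ProjSteps (cn, σn) a [v] 1 cfg') →
    ∀ ρ t' v', D.rel a c σ n ρ σ → Produces c ρ a (t' ++ [v']) → t'.length = t.length →
      v' = v

/-- A counting attacker always remembers at least how many outputs it has seen. -/
def Attacker.Counting {S : Type} (A : Attacker S) : Prop :=
  ∀ t t' : List Val, A.run t = A.run t' → t.length = t'.length

/-- A command is quasi-constant if, per channel, all its traces are prefixes of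
one fixed (possibly infinite) trace. -/
def QuasiConstant (c : Cmd) : Prop :=
  ∀ a : Chan, ∃ u : ℕ → Val, ∀ σ t, Produces c σ a t →
    ∀ i : Fin t.length, t.get i = u i.val

/-- The variables of the dependency type system. -/
inductive TVar where
  | pvar : PVar → TVar
  | cpoint : Chan → PPoint → TVar
  | pc : TVar
  | chan : Chan → TVar
deriving DecidableEq

/-- Type environments. -/
abbrev Env := TVar → Set TVar

/-- The identity environment. -/
def idEnv : Env := fun x => {x}

/-- Sequential composition of environments: `(Γ₂;Γ₁)(x) = ⋃_{y ∈ Γ₂(x)} Γ₁(y)`. -/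
def envComp (Γ₂ Γ₁ : Env) : Env := fun x => ⋃ y ∈ Γ₂ x, Γ₁ y

/-- Pointwise union of environments. -/
def envUnion (Γ₁ Γ₂ : Env) : Env := fun x => Γ₁ x ∪ Γ₂ x

/-- Iterates of an environment. -/
def envIter (Γ : Env) : ℕ → Env
  | 0 => idEnv
  | n+1 => envComp (envIter Γ n) Γ

/-- The fixed point `Γ* = ⋃_{n≥0} Γⁿ`. -/
def envStar (Γ : Env) : Env := fun x => ⋃ n, envIter Γ n x

/-- Free variables of an expression, as type-system variables. -/
def fvT (e : Expr) : Set TVar := TVar.pvar '' e.fv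

/-- The dependency type system `⊢{c}Γ`. -/
inductive Typing : Cmd → Env → Prop where
  | skip : Typing .skip idEnv
  | assign : ∀ (x : PVar) (e : Expr),
      Typing (.assign x e) (Function.update idEnv (.pvar x) (fvT e ∪ {TVar.pc}))
  | seq : ∀ {c₁ : Cmd} {Γ₁ : Env} {c₂ : Cmd} {Γ₂ : Env},
      Typing c₁ Γ₁ → Typing c₂ Γ₂ → Typing (.seq c₁ c₂) (envComp Γ₂ Γ₁)
  | ite : ∀ {e : Expr} {c₁ : Cmd} {Γ₁ : Env} {c₂ : Cmd} {Γ₂ : Env},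
      Typing c₁ Γ₁ → Typing c₂ Γ₂ →
      Typing (.ite e c₁ c₂)
        (Function.update
          (envUnion (envComp Γ₁ (Function.update idEnv .pc ({TVar.pc} ∪ fvT e)))
                    (envComp Γ₂ (Function.update idEnv .pc ({TVar.pc} ∪ fvT e))))
          .pc {TVar.pc})
  | whileT : ∀ {e : Expr} {c : Cmd} {Γc : Env}, Typing c Γc →
      Typing (.while e c)
        (Function.update
          (envStar (envComp Γc (Function.update idEnv .pc ({TVar.pc} ∪ fvT e))))
          .pc {TVar.pc})
  | out : ∀ (e : Expr) (a : Chan) (p : PPoint),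
      Typing (.out e a p)
        (Function.update
          (Function.update idEnv (.cpoint a p)
            (fvT e ∪ {TVar.pc, TVar.chan a, TVar.cpoint a p}))
          (.chan a) {TVar.pc, TVar.chan a})

/-- `σ ≡_{Γ(x)} ρ`: the stores agree on all program variables in `Γ(x)`. -/
def eqG (Γ : Env) (x : TVar) (σ ρ : Store) : Prop :=
  ∀ y : PVar, TVar.pvar y ∈ Γ x → σ y = ρ y

/-- A dynamic policy approximation: an equivalence relation on stores per
channel–program-point pair. -/
structure PolApprox where
  rel : Chan → PPoint → Store → Store → Prop
  isEquiv : ∀ a p, Equivalence (rel a p)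

/-- `c : A` is a sound approximation of dynamic policy `D`. -/
def SoundApprox (c : Cmd) (A : PolApprox) (D : DynPolicy) : Prop :=
  ∀ σ n ls c' σ' a v p cfg'',
    Steps (c, σ) ls n (c', σ') → Step (c', σ') (.out a v p) cfg'' →
    ∀ ρ₁ ρ₂, D.rel a c σ n ρ₁ ρ₂ → A.rel a p ρ₁ ρ₂

/-- `x` is syntactically assigned in a command. -/
def Asg (x : PVar) : Cmd → Prop
  | .skip => False
  | .seq c₁ c₂ => Asg x c₁ ∨ Asg x c₂
  | .assign y _ => x = y
  | .ite _ c₁ c₂ => Asg x c₁ ∨ Asg x c₂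
  | .while _ c => Asg x c
  | .out _ _ _ => False

/-- An output on channel `a` at point `p` occurs syntactically in a command. -/
def Outs (a : Chan) (p : PPoint) : Cmd → Prop
  | .skip => False
  | .seq c₁ c₂ => Outs a p c₁ ∨ Outs a p c₂
  | .assign _ _ => False
  | .ite _ c₁ c₂ => Outs a p c₁ ∨ Outs a p c₂
  | .while _ c => Outs a p c
  | .out _ b q => a = b ∧ p = q

theorem step_asg (x : PVar) {cfg : Config} {α : Label} {cfg' : Config} (h : Step cfg α cfg') :
    (Asg x cfg'.1 → Asg x cfg.1) ∧ (¬ Asg x cfg.1 → cfg'.2 x = cfg.2 x) := by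
  induction h <;> simp_all [Asg] <;> tauto

theorem step_outs (a : Chan) (p : PPoint) {cfg : Config} {α : Label} {cfg' : Config}
    (h : Step cfg α cfg') :
    (Outs a p cfg'.1 → Outs a p cfg.1) ∧ (∀ v, α = .out a v p → Outs a p cfg.1) := by
  induction h with
  | seq c₂ h ih =>
    simp only [Outs] at *
    exact ⟨fun h => h.imp ih.1 id, fun v hv => Or.inl (ih.2 v hv)⟩
  | out e b q σ =>
    simp only [Outs]
    refine ⟨fun h => h.elim, fun v hv => ?_⟩
    injection hv with h1 h2 h3
    exact ⟨h1.symm, h3.symm⟩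
  | _ => simp_all [Outs]

theorem steps_asg (x : PVar) {cfg : Config} {ls : List Label} {n : ℕ} {cfg' : Config}
    (h : Steps cfg ls n cfg') (hx : ¬ Asg x cfg.1) : cfg'.2 x = cfg.2 x := by
  induction h with
  | refl => rfl
  | step h1 _ ih =>
    obtain ⟨h2, h3⟩ := step_asg x h1
    rw [ih (fun h => hx (h2 h)), h3 hx]

theorem steps_outs (a : Chan) (p : PPoint) {cfg : Config} {ls : List Label} {n : ℕ} {cfg' : Config}
    (h : Steps cfg ls n cfg') (hx : ¬ Outs a p cfg.1) (v : Val) : Label.out a v p ∉ ls := by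
  induction h with
  | refl => simp
  | @step cfg α cfg1 ls n cfg2 h1 _ ih =>
    obtain ⟨h2, h3⟩ := step_outs a p h1
    have := ih (fun h => hx (h2 h))
    cases α with
    | silent => exact this
    | out b w q =>
      simp only [Label.consTo, List.mem_cons, not_or]
      exact ⟨fun hh => hx (h3 v hh.symm), this⟩

/-- number of outputs on channel `a` -/
def cnt (a : Chan) (ls : List Label) : ℕ := (projA a ls).length

theorem cnt_nil (a : Chan) : cnt a [] = 0 := rfl

theorem cnt_append (a : Chan) (l₁ l₂ : List Label) : cnt a (l₁ ++ l₂) = cnt a l₁ + cnt a l₂ := by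
  simp [cnt, projA]

theorem cnt_zero (a : Chan) {cfg : Config} {ls : List Label} {n : ℕ} {cfg' : Config}
    (h : Steps cfg ls n cfg') (hx : ∀ p, ¬ Outs a p cfg.1) : cnt a ls = 0 := by
  have := fun p v => steps_outs a p h (hx p) v
  unfold cnt projA
  rw [List.length_eq_zero_iff, List.filterMap_eq_nil_iff]
  intro l hl
  cases l with
  | silent => rfl
  | out b w q =>
    by_cases hb : b = a
    · subst hb
      exact absurd hl (this q w)
    · simp [hb]

theorem consTo_append (α : Label) (l₁ l₂ : List Label) :
    α.consTo l₁ ++ l₂ = α.consTo (l₁ ++ l₂) := by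
  cases α <;> rfl

theorem steps_skip {σ : Store} {ls : List Label} {n : ℕ} {cfg' : Config}
    (h : Steps (.skip, σ) ls n cfg') : ls = [] ∧ cfg' = (.skip, σ) := by
  cases h with
  | refl => exact ⟨rfl, rfl⟩
  | step h1 _ => cases h1

theorem steps_seq (c₂ : Cmd) {n : ℕ} : ∀ {c₁ : Cmd} {σ : Store} {ls : List Label} {cfg' : Config},
    Steps (.seq c₁ c₂, σ) ls n cfg' →
    (cfg'.1 ≠ .skip ∧ ∃ cfg'', Steps (c₁, σ) ls n cfg'') ∨
    ∃ σ₁ ls₁ n₁ ls₂ n₂, Steps (c₁, σ) ls₁ n₁ (.skip, σ₁) ∧ Steps (c₂, σ₁) ls₂ n₂ cfg' ∧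
      ls = ls₁ ++ ls₂ ∧ n₂ < n := by
  induction n with
  | zero =>
    intro c₁ σ ls cfg' h
    cases h
    exact Or.inl ⟨by simp, _, Steps.refl _⟩
  | succ n ih =>
    intro c₁ σ ls cfg' h
    cases h with
    | step h1 h2 =>
      cases h1 with
      | skipSeq => exact Or.inr ⟨σ, [], 0, _, n, Steps.refl _, h2, rfl, by omega⟩
      | seq _ h1 =>
        rcases ih h2 with ⟨h3, cfg'', h4⟩ | ⟨σ₁, ls₁, n₁, ls₂, n₂, h3, h4, h5, h6⟩
        · exact Or.inl ⟨h3, cfg'', Steps.step h1 h4⟩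
        · refine Or.inr ⟨σ₁, _, _, ls₂, n₂, Steps.step h1 h3, h4, ?_, by omega⟩
          rw [h5, consTo_append]

theorem steps_ite {e : Expr} {c₁ c₂ : Cmd} {σ : Store} {ls : List Label} {n : ℕ} {cfg' : Config}
    (h : Steps (.ite e c₁ c₂, σ) ls n cfg') :
    (cfg'.1 ≠ .skip ∧ ls = []) ∨
    ∃ m, m < n ∧ ((e.eval σ ≠ 0 ∧ Steps (c₁, σ) ls m cfg') ∨
      (e.eval σ = 0 ∧ Steps (c₂, σ) ls m cfg')) := by
  cases h with
  | refl => exact Or.inl ⟨by simp, rfl⟩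
  | @step _ _ _ _ m _ h1 h2 =>
    refine Or.inr ⟨m, by omega, ?_⟩
    cases h1 with
    | iteTrue _ _ h => exact Or.inl ⟨h, h2⟩
    | iteFalse _ _ h => exact Or.inr ⟨h, h2⟩

theorem steps_while {e : Expr} {c : Cmd} {σ : Store} {ls : List Label} {n : ℕ} {cfg' : Config}
    (h : Steps (.while e c, σ) ls n cfg') :
    (cfg'.1 ≠ .skip ∧ ls = []) ∨
    (e.eval σ = 0 ∧ ls = [] ∧ cfg' = (.skip, σ)) ∨
    (e.eval σ ≠ 0 ∧ cfg'.1 ≠ .skip ∧ ∃ m cfg'', Steps (c, σ) ls m cfg'') ∨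
    (e.eval σ ≠ 0 ∧ ∃ σ₁ ls₁ n₁ ls₂ n₂, Steps (c, σ) ls₁ n₁ (.skip, σ₁) ∧
      Steps (.while e c, σ₁) ls₂ n₂ cfg' ∧ ls = ls₁ ++ ls₂ ∧ n₂ < n) := by
  cases h with
  | refl => exact Or.inl ⟨by simp, rfl⟩
  | step h1 h2 =>
    cases h1
    rcases steps_ite h2 with h | ⟨m, hm, ⟨he, h⟩ | ⟨he, h⟩⟩
    · exact Or.inl h
    · rcases steps_seq _ h with ⟨h3, h4⟩ | ⟨σ₁, ls₁, n₁, ls₂, n₂, h3, h4, h5, h6⟩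
      · exact Or.inr (Or.inr (Or.inl ⟨he, h3, m, h4⟩))
      · exact Or.inr (Or.inr (Or.inr ⟨he, σ₁, ls₁, n₁, ls₂, n₂, h3, h4, h5, by omega⟩))
    · exact Or.inr (Or.inl ⟨he, steps_skip h⟩)

/-- The environment `Γ_id[pc ↦ {pc} ∪ fv(e)]`. -/
abbrev pcE (e : Expr) : Env := Function.update idEnv .pc ({TVar.pc} ∪ fvT e)

theorem mem_envComp {Γ₂ Γ₁ : Env} {x y z : TVar} (h : y ∈ Γ₂ x) (h' : z ∈ Γ₁ y) :
    z ∈ envComp Γ₂ Γ₁ x := by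
  simp only [envComp, Set.mem_iUnion]
  exact ⟨y, h, h'⟩

theorem mem_upd {Γ : Env} {S : Set TVar} {x y : TVar} (hx : x ≠ .pc) (h : y ∈ Γ x) :
    y ∈ Function.update Γ .pc S x := by
  rwa [Function.update_of_ne hx]

theorem mem_pcE (e : Expr) (y : TVar) : y ∈ pcE e y := by
  by_cases h : y = .pc
  · subst h; simp [pcE]
  · simp [pcE, h, idEnv]

theorem mem_comp_pcE {Γ : Env} (e : Expr) {x y : TVar} (h : y ∈ Γ x) :
    y ∈ envComp Γ (pcE e) x := mem_envComp h (mem_pcE e y)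

theorem fv_comp_pcE {Γ : Env} (e : Expr) {x y : TVar} (h : TVar.pc ∈ Γ x) (hy : y ∈ fvT e) :
    y ∈ envComp Γ (pcE e) x := mem_envComp h (by simp [pcE, hy])

theorem mem_star_id (G : Env) (x : TVar) : x ∈ envStar G x := by
  simp only [envStar, Set.mem_iUnion]
  exact ⟨0, rfl⟩

theorem mem_star_comp {G : Env} {x y z : TVar} (h : y ∈ envStar G x) (h' : z ∈ G y) :
    z ∈ envStar G x := by
  simp only [envStar, Set.mem_iUnion] at *
  obtain ⟨n, hn⟩ := h
  exact ⟨n + 1, mem_envComp hn h'⟩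

theorem mem_star_one {G : Env} {x z : TVar} (h' : z ∈ G x) : z ∈ envStar G x :=
  mem_star_comp (mem_star_id G x) h'

theorem eval_agree {e : Expr} {σ ρ : Store} (h : ∀ y, TVar.pvar y ∈ fvT e → σ y = ρ y) :
    e.eval σ = e.eval ρ := by
  cases e with
  | const v => rfl
  | var x => exact h x ⟨x, rfl, rfl⟩

/-- Structural invariants of derivable environments. -/
structure TyInv (c : Cmd) (Γ : Env) : Prop where
  pc : Γ .pc = {TVar.pc}
  chan : ∀ a, TVar.chan a ∈ Γ (.chan a)
  point : ∀ a p, TVar.cpoint a p ∈ Γ (.cpoint a p)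
  asg : ∀ x, Asg x c → TVar.pc ∈ Γ (.pvar x)
  nasg : ∀ x, ¬ Asg x c → TVar.pvar x ∈ Γ (.pvar x)
  outc : ∀ a p, Outs a p c → TVar.pc ∈ Γ (.chan a)
  outp : ∀ a p, Outs a p c → TVar.chan a ∈ Γ (.cpoint a p)

theorem typing_inv {c : Cmd} {Γ : Env} (h : Typing c Γ) : TyInv c Γ := by
  induction h with
  | skip => constructor <;> simp [idEnv, Asg, Outs]
  | assign x e => constructor <;> simp +contextual [idEnv, Asg, Outs, Function.update_apply]
  | out e a p =>
    constructor <;> simp +contextual [idEnv, Asg, Outs, Function.update_apply]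
    · intro b; split <;> simp_all
    · intro b q; split <;> simp_all
  | @seq c₁ Γ₁ c₂ Γ₂ _ _ i1 i2 =>
    have hpc : TVar.pc ∈ Γ₁ .pc := by rw [i1.pc]; rfl
    constructor
    · ext y; simp [envComp, i2.pc, i1.pc]
    · exact fun a => mem_envComp (i2.chan a) (i1.chan a)
    · exact fun a p => mem_envComp (i2.point a p) (i1.point a p)
    · intro x hx
      by_cases h2 : Asg x c₂
      · exact mem_envComp (i2.asg x h2) hpc
      · exact mem_envComp (i2.nasg x h2) (i1.asg x (hx.resolve_right h2))
    · intro x hx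
      simp only [Asg, not_or] at hx
      exact mem_envComp (i2.nasg x hx.2) (i1.nasg x hx.1)
    · rintro a p (h | h)
      · exact mem_envComp (i2.chan a) (i1.outc a p h)
      · exact mem_envComp (i2.outc a p h) hpc
    · rintro a p (h | h)
      · exact mem_envComp (i2.point a p) (i1.outp a p h)
      · exact mem_envComp (i2.outp a p h) (i1.chan a)
  | @ite e c₁ Γ₁ c₂ Γ₂ _ _ i1 i2 =>
    constructor
    · simp
    · exact fun a => by exact mem_upd (by simp) <| Or.inl (mem_comp_pcE e (i1.chan a))
    · exact fun a p => by exact mem_upd (by simp) <| Or.inl (mem_comp_pcE e (i1.point a p))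
    · rintro x (h | h)
      · exact mem_upd (by simp) <| Or.inl (mem_comp_pcE e (i1.asg x h))
      · exact mem_upd (by simp) <| Or.inr (mem_comp_pcE e (i2.asg x h))
    · intro x hx
      simp only [Asg, not_or] at hx
      exact mem_upd (by simp) <| Or.inl (mem_comp_pcE e (i1.nasg x hx.1))
    · rintro a p (h | h)
      · exact mem_upd (by simp) <| Or.inl (mem_comp_pcE e (i1.outc a p h))
      · exact mem_upd (by simp) <| Or.inr (mem_comp_pcE e (i2.outc a p h))
    · rintro a p (h | h)
      · exact mem_upd (by simp) <| Or.inl (mem_comp_pcE e (i1.outp a p h))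
      · exact mem_upd (by simp) <| Or.inr (mem_comp_pcE e (i2.outp a p h))
  | @whileT e c Γc _ i =>
    constructor
    · simp
    · exact fun a => by exact mem_upd (by simp) <| mem_star_id _ _
    · exact fun a p => by exact mem_upd (by simp) <| mem_star_id _ _
    · exact fun x h => by exact mem_upd (by simp) <| mem_star_one (mem_comp_pcE e (i.asg x h))
    · exact fun x _ => by exact mem_upd (by simp) <| mem_star_id _ _
    · exact fun a p h => by exact mem_upd (by simp) <| mem_star_one (mem_comp_pcE e (i.outc a p h))
    · exact fun a p h => by exact mem_upd (by simp) <| mem_star_one (mem_comp_pcE e (i.outp a p h))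

/-- Soundness for variables (termination-insensitive). -/
def SoundV (c : Cmd) (Γ : Env) : Prop :=
  ∀ (x : PVar) (σ ρ σ' ρ' : Store) (ls ls' : List Label) (n m : ℕ),
    Steps (c, σ) ls n (.skip, σ') → Steps (c, ρ) ls' m (.skip, ρ') →
    eqG Γ (.pvar x) σ ρ → σ' x = ρ' x

def SoundC (c : Cmd) (Γ : Env) : Prop :=
  ∀ (a : Chan) (σ ρ σ' : Store) (cfg' : Config) (ls ls' : List Label) (n m : ℕ),
    Steps (c, σ) ls n (.skip, σ') → Steps (c, ρ) ls' m cfg' →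
    eqG Γ (.chan a) σ ρ → cnt a ls' ≤ cnt a ls ∧ (cfg'.1 = .skip → cnt a ls' = cnt a ls)

theorem typing_soundV {c : Cmd} {Γ : Env} (h : Typing c Γ) : SoundV c Γ := by
  induction h with
  | skip =>
    intro x σ ρ σ' ρ' ls ls' n m h1 h2 he
    obtain ⟨-, h1⟩ := steps_skip h1
    obtain ⟨-, h2⟩ := steps_skip h2
    cases h1; cases h2
    exact he x rfl
  | assign y e =>
    intro x σ ρ σ' ρ' ls ls' n m h1 h2 he
    cases h1 with
    | step s1 h1 =>
    cases s1
    obtain ⟨-, h1⟩ := steps_skip h1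
    cases h2 with
    | step s2 h2 =>
    cases s2
    obtain ⟨-, h2⟩ := steps_skip h2
    cases h1; cases h2
    by_cases hx : x = y
    · subst hx
      simp only [Function.update_self]
      exact eval_agree fun z hz => he z (by simp [hz])
    · simp only [Function.update_of_ne hx]
      exact he x (by simp [hx, idEnv])
  | out e a p =>
    intro x σ ρ σ' ρ' ls ls' n m h1 h2 he
    have e1 := steps_asg x h1 (by simp [Asg])
    have e2 := steps_asg x h2 (by simp [Asg])
    simp only at e1 e2
    rw [e1, e2]
    exact he x (by simp [idEnv])
  | @seq c₁ Γ₁ c₂ Γ₂ _ _ ih1 ih2 =>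
    intro x σ ρ σ' ρ' ls ls' n m h1 h2 he
    rcases steps_seq _ h1 with ⟨h, _⟩ | ⟨σ₁, ls₁, n₁, ls₂, n₂, a1, a2, -, -⟩
    · exact absurd rfl h
    rcases steps_seq _ h2 with ⟨h, _⟩ | ⟨ρ₁, ls₁', n₁', ls₂', n₂', b1, b2, -, -⟩
    · exact absurd rfl h
    refine ih2 x _ _ _ _ _ _ _ _ a2 b2 fun y hy => ?_
    exact ih1 y _ _ _ _ _ _ _ _ a1 b1 fun z hz => he z (mem_envComp hy hz)
  | @ite e c₁ Γ₁ c₂ Γ₂ t1 t2 ih1 ih2 =>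
    intro x σ ρ σ' ρ' ls ls' n m h1 h2 he
    have i1 := typing_inv t1
    have i2 := typing_inv t2
    by_cases hx : Asg x (.ite e c₁ c₂)
    · have hev : e.eval σ = e.eval ρ := eval_agree fun y hy => he y (by
        rcases hx with hx | hx
        · exact mem_upd (by simp) <| Or.inl (fv_comp_pcE e (i1.asg x hx) hy)
        · exact mem_upd (by simp) <| Or.inr (fv_comp_pcE e (i2.asg x hx) hy))
      rcases steps_ite h1 with ⟨h, _⟩ | ⟨k, -, ⟨g1, a1⟩ | ⟨g1, a1⟩⟩
      · exact absurd rfl h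
      all_goals
        rcases steps_ite h2 with ⟨h, _⟩ | ⟨k', -, ⟨g2, b1⟩ | ⟨g2, b1⟩⟩
        · exact absurd rfl h
      · exact ih1 x _ _ _ _ _ _ _ _ a1 b1 fun y hy =>
          he y (by exact mem_upd (by simp) <| Or.inl (mem_comp_pcE e hy))
      · exact absurd (hev.trans g2) g1
      · exact absurd (hev.symm.trans g1) g2
      · exact ih2 x _ _ _ _ _ _ _ _ a1 b1 fun y hy =>
          he y (by exact mem_upd (by simp) <| Or.inr (mem_comp_pcE e hy))
    · have e1 := steps_asg x h1 hx
      have e2 := steps_asg x h2 hx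
      simp only at e1 e2
      rw [e1, e2]
      simp only [Asg, not_or] at hx
      exact he x (by exact mem_upd (by simp) <| Or.inl (mem_comp_pcE e (i1.nasg x hx.1)))
  | @whileT e c Γc t ih =>
    intro x σ ρ σ' ρ' ls ls' n m h1 h2 he
    have i := typing_inv t
    by_cases hx : Asg x (.while e c)
    · induction n using Nat.strong_induction_on generalizing σ ρ ls ls' m with
      | _ n IH =>
      have hev : e.eval σ = e.eval ρ := eval_agree fun y hy => he y (by
        exact mem_upd (by simp) <| mem_star_one (fv_comp_pcE e (i.asg x hx) hy))
      rcases steps_while h1 with ⟨h, _⟩ | ⟨g1, -, a1⟩ | ⟨_, h, _⟩ |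
        ⟨g1, σ₁, ls₁, n₁, ls₂, n₂, a1, a2, -, hn⟩
      · exact absurd rfl h
      · rcases steps_while h2 with ⟨h, _⟩ | ⟨g2, -, b1⟩ | ⟨_, h, _⟩ | ⟨g2, _⟩
        · exact absurd rfl h
        · cases a1; cases b1
          exact he x (by exact mem_upd (by simp) <| mem_star_id _ _)
        · exact absurd rfl h
        · exact absurd (hev.symm.trans g1) g2
      · exact absurd rfl h
      · rcases steps_while h2 with ⟨h, _⟩ | ⟨g2, -, b1⟩ | ⟨_, h, _⟩ |
          ⟨g2, ρ₁, ls₁', n₁', ls₂', n₂', b1, b2, -, -⟩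
        · exact absurd rfl h
        · exact absurd (hev.trans g2) g1
        · exact absurd rfl h
        · refine IH n₂ hn σ₁ ρ₁ _ _ _ a2 b2 fun y hy => ?_
          refine ih y _ _ _ _ _ _ _ _ a1 b1 fun z hz => he z ?_
          simp only [ne_eq, reduceCtorEq, not_false_eq_true, Function.update_of_ne] at hy ⊢
          exact mem_star_comp hy (mem_comp_pcE e hz)
    · have e1 := steps_asg x h1 hx
      have e2 := steps_asg x h2 hx
      simp only at e1 e2
      rw [e1, e2]
      exact he x (by exact mem_upd (by simp) <| mem_star_id _ _)

theorem soundC_of_no_outs {a : Chan} {c : Cmd} (ho : ¬ ∃ p, Outs a p c) {σ ρ : Store}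
    {cfg cfg' : Config} {ls ls' : List Label} {n m : ℕ}
    (h1 : Steps (c, σ) ls n cfg) (h2 : Steps (c, ρ) ls' m cfg') :
    cnt a ls' ≤ cnt a ls ∧ (cfg'.1 = .skip → cnt a ls' = cnt a ls) := by
  rw [cnt_zero a h1 (fun p h => ho ⟨p, h⟩), cnt_zero a h2 (fun p h => ho ⟨p, h⟩)]
  simp

theorem typing_soundC {c : Cmd} {Γ : Env} (h : Typing c Γ) : SoundC c Γ := by
  induction h with
  | skip =>
    intro a σ ρ σ' cfg' ls ls' n m h1 h2 he
    exact soundC_of_no_outs (by simp [Outs]) h1 h2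
  | assign y e =>
    intro a σ ρ σ' cfg' ls ls' n m h1 h2 he
    exact soundC_of_no_outs (by simp [Outs]) h1 h2
  | out e b p =>
    intro a σ ρ σ' cfg' ls ls' n m h1 h2 he
    cases h1 with
    | step s1 h1 =>
    cases s1
    obtain ⟨rfl, -⟩ := steps_skip h1
    cases h2 with
    | refl => simp [cnt_nil]
    | step s2 h2 =>
    cases s2
    obtain ⟨rfl, -⟩ := steps_skip h2
    by_cases hb : b = a <;> simp [cnt, projA, Label.consTo, hb]
  | @seq c₁ Γ₁ c₂ Γ₂ t1 t2 ih1 ih2 =>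
    intro a σ ρ σ' cfg' ls ls' n m h1 h2 he
    have i2 := typing_inv t2
    rcases steps_seq _ h1 with ⟨h, _⟩ | ⟨σ₁, ls₁, n₁, ls₂, n₂, a1, a2, rfl, -⟩
    · exact absurd rfl h
    have he1 : eqG Γ₁ (.chan a) σ ρ := fun z hz => he z (mem_envComp (i2.chan a) hz)
    rw [cnt_append]
    rcases steps_seq _ h2 with ⟨h, cfg'', b⟩ | ⟨ρ₁, ls₁', n₁', ls₂', n₂', b1, b2, rfl, -⟩
    · have := (ih1 a _ _ _ _ _ _ _ _ a1 b he1).1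
      exact ⟨by omega, fun h' => absurd h' h⟩
    · have k1 := (ih1 a _ _ _ _ _ _ _ _ a1 b1 he1).2 rfl
      have k2 := ih2 a _ _ _ _ _ _ _ _ a2 b2 fun y hy =>
        typing_soundV t1 y _ _ _ _ _ _ _ _ a1 b1 fun z hz => he z (mem_envComp hy hz)
      rw [cnt_append]
      exact ⟨by omega, fun h' => by have := k2.2 h'; omega⟩
  | @ite e c₁ Γ₁ c₂ Γ₂ t1 t2 ih1 ih2 =>
    intro a σ ρ σ' cfg' ls ls' n m h1 h2 he
    have i1 := typing_inv t1
    have i2 := typing_inv t2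
    by_cases hx : ∃ p, Outs a p (.ite e c₁ c₂)
    · have hev : e.eval σ = e.eval ρ := eval_agree fun y hy => he y (by
        obtain ⟨p, hx | hx⟩ := hx
        · exact mem_upd (by simp) <| Or.inl (fv_comp_pcE e (i1.outc a p hx) hy)
        · exact mem_upd (by simp) <| Or.inr (fv_comp_pcE e (i2.outc a p hx) hy))
      rcases steps_ite h2 with ⟨h, rfl⟩ | ⟨k', -, ⟨g2, b1⟩ | ⟨g2, b1⟩⟩
      · exact ⟨by simp [cnt_nil], fun h' => absurd h' h⟩
      all_goals
        rcases steps_ite h1 with ⟨h, _⟩ | ⟨k, -, ⟨g1, a1⟩ | ⟨g1, a1⟩⟩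
        · exact absurd rfl h
      · exact ih1 a _ _ _ _ _ _ _ _ a1 b1 fun y hy =>
          he y (by exact mem_upd (by simp) <| Or.inl (mem_comp_pcE e hy))
      · exact absurd (hev.symm.trans g1) g2
      · exact absurd (hev.trans g2) g1
      · exact ih2 a _ _ _ _ _ _ _ _ a1 b1 fun y hy =>
          he y (by exact mem_upd (by simp) <| Or.inr (mem_comp_pcE e hy))
    · exact soundC_of_no_outs hx h1 h2
  | @whileT e c Γc t ih =>
    intro a σ ρ σ' cfg' ls ls' n m h1 h2 he
    have i := typing_inv t
    by_cases hx : ∃ p, Outs a p (.while e c)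
    · induction n using Nat.strong_induction_on generalizing σ ρ ls ls' m with
      | _ n IH =>
      have hev : e.eval σ = e.eval ρ := eval_agree fun y hy => he y (by
        obtain ⟨p, hx⟩ := hx
        exact mem_upd (by simp) <| mem_star_one (fv_comp_pcE e (i.outc a p hx) hy))
      have he1 : eqG Γc (.chan a) σ ρ := fun z hz => he z (by
        exact mem_upd (by simp) <| mem_star_one (mem_comp_pcE e hz))
      rcases steps_while h1 with ⟨h, _⟩ | ⟨g1, rfl, a1⟩ | ⟨_, h, _⟩ |
        ⟨g1, σ₁, ls₁, n₁, ls₂, n₂, a1, a2, rfl, hn⟩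
      · exact absurd rfl h
      · rcases steps_while h2 with ⟨h, rfl⟩ | ⟨g2, rfl, b1⟩ | ⟨g2, _⟩ | ⟨g2, _⟩
        · simp
        · simp
        · exact absurd (hev.symm.trans g1) g2
        · exact absurd (hev.symm.trans g1) g2
      · exact absurd rfl h
      · rw [cnt_append]
        rcases steps_while h2 with ⟨h, rfl⟩ | ⟨g2, -, b1⟩ | ⟨_, h, k, cfg'', b⟩ |
          ⟨g2, ρ₁, ls₁', n₁', ls₂', n₂', b1, b2, rfl, -⟩
        · exact ⟨by simp [cnt_nil], fun h' => absurd h' h⟩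
        · exact absurd (hev.trans g2) g1
        · have := (ih a _ _ _ _ _ _ _ _ a1 b he1).1
          exact ⟨by omega, fun h' => absurd h' h⟩
        · have k1 := (ih a _ _ _ _ _ _ _ _ a1 b1 he1).2 rfl
          have k2 := IH n₂ hn σ₁ ρ₁ _ _ _ a2 b2 fun y hy => by
            refine typing_soundV t y _ _ _ _ _ _ _ _ a1 b1 fun z hz => he z ?_
            simp only [ne_eq, reduceCtorEq, not_false_eq_true, Function.update_of_ne] at hy ⊢
            exact mem_star_comp hy (mem_comp_pcE e hz)
          rw [cnt_append]
          exact ⟨by omega, fun h' => by have := k2.2 h'; omega⟩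
    · exact soundC_of_no_outs hx h1 h2

/-- channel context bounds lemma. -/
theorem channel_context_bounds {c : Cmd} {Γ : Env} (hty : Typing c Γ) :
    (∀ (a : Chan) (σ ρ σ' : Store) (t : List Val) (n : ℕ),
       ProjSteps (c, σ) a t n (.skip, σ') → eqG Γ (.chan a) σ ρ →
       (∀ t' : List Val, Produces c ρ a t' → t'.length ≤ t.length) ∧
       (∀ (t' : List Val) (m : ℕ) (ρ' : Store),
          ProjSteps (c, ρ) a t' m (.skip, ρ') → t'.length = t.length)) ∧
    (∀ (a : Chan) (p : PPoint), TVar.chan a ∉ Γ (.cpoint a p) →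
       ∀ (σ : Store) (ls : List Label) (n : ℕ) (cfg' : Config),
         Steps (c, σ) ls n cfg' → ∀ v : Val, Label.out a v p ∉ ls) := by
  refine ⟨?_, ?_⟩
  · rintro a σ ρ σ' t n ⟨ls, h1, rfl⟩ he
    refine ⟨?_, ?_⟩
    · rintro t' ⟨m, cfg', ls', h2, rfl⟩
      exact (typing_soundC hty a _ _ _ _ _ _ _ _ h1 h2 he).1
    · rintro t' m ρ' ⟨ls', h2, rfl⟩
      exact (typing_soundC hty a _ _ _ _ _ _ _ _ h1 h2 he).2 rfl
  · intro a p hp σ ls n cfg' h v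
    exact steps_outs a p h (fun ho => hp ((typing_inv hty).outp a p ho)) v
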